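/- Let V ⊆ [0,1] be finite with {0,1} ⊆ V. For every BQCTL*[F] state formula Eψ, every (AP,V)-labelled D-tree t and every node u of t, the supremum defining ⟦Eψ⟧_t(u) is attained: there exists a branch λ ∈ Br_t(u) such that ⟦ψ⟧_t(λ) = ⟦Eψ⟧_t(u); consequently ⟦Eψ⟧_t(u) ∈ V(ψ), the set of satisfaction values of ψ over branches of (AP,V)-labelled D-trees. -/

import Mathlib

open scoped Classical

mutual
inductive StateF (AP : Type) : Type where
  | atom : AP → StateF AP
  | app : (n : ℕ) → ((Fin n → ℝ) → ℝ) → (Fin n → StateF AP) → StateF AP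
  | ex : AP → StateF AP → StateF AP
  | E : PathF AP → StateF AP

inductive PathF (AP : Type) : Type where
  | state : StateF AP → PathF AP
  | next : PathF AP → PathF AP
  | until_ : PathF AP → PathF AP → PathF AP
  | app : (n : ℕ) → ((Fin n → ℝ) → ℝ) → (Fin n → PathF AP) → PathF AP
end

variable {AP D : Type}

mutual
def ssize : StateF AP → ℕ
  | .atom _ => 1
  | .app n _ args => 1 + Finset.univ.sum (fun i : Fin n => ssize (args i))
  | .ex _ φ => 1 + ssize φ
  | .E ψ => 1 + psize ψ
def psize : PathF AP → ℕ
  | .state φ => ssize φ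
  | .next ψ => 1 + psize ψ
  | .until_ ψ₁ ψ₂ => 1 + psize ψ₁ + psize ψ₂
  | .app n _ args => 1 + Finset.univ.sum (fun i : Fin n => psize (args i))
end

structure LTree (D L : Type) where
  dom : Set (List D)
  label : List D → L

def IsTree (t : LTree D L) : Prop :=
  ([] ∈ t.dom) ∧ (∀ u ∈ t.dom, ∀ v : List D, v <+: u → v ∈ t.dom) ∧
    (∀ u ∈ t.dom, ∃ d : D, u ++ [d] ∈ t.dom)

def Labelled (t : LTree D (AP → ℝ)) (V : Set ℝ) : Prop :=
  ∀ u ∈ t.dom, ∀ p, t.label u p ∈ V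

def IsBranch (t : LTree D L) (u : List D) (lam : ℕ → List D) : Prop :=
  lam 0 = u ∧ ∀ i, lam i ∈ t.dom ∧ ∃ d : D, lam (i + 1) = lam i ++ [d]

def PropEquiv (p : AP) (t t' : LTree D (AP → ℝ)) : Prop :=
  t'.dom = t.dom ∧
    ∀ u ∈ t.dom, (∀ q, q ≠ p → t'.label u q = t.label u q) ∧
      (t'.label u p = 0 ∨ t'.label u p = 1)

mutual
noncomputable def ssem : StateF AP → LTree D (AP → ℝ) → List D → ℝ
  | .atom p, t, u => t.label u p
  | .app n f args, t, u => f fun i => ssem (args i) t u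
  | .ex p φ, t, u => sSup {v | ∃ t', PropEquiv p t t' ∧ ssem φ t' u = v}
  | .E ψ, t, u => sSup {v | ∃ lam, IsBranch t u lam ∧ psem ψ t lam = v}
noncomputable def psem : PathF AP → LTree D (AP → ℝ) → (ℕ → List D) → ℝ
  | .state φ, t, lam => ssem φ t (lam 0)
  | .next ψ, t, lam => psem ψ t fun k => lam (1 + k)
  | .until_ ψ₁ ψ₂, t, lam =>
      sSup {v | ∃ i : ℕ,
        v = min (psem ψ₂ t fun k => lam (i + k))
          (sInf ({w | ∃ j < i, psem ψ₁ t (fun k => lam (j + k)) = w} ∪ {1}))}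
  | .app n f args, t, lam => f fun i => psem (args i) t lam
end

def ValS (D : Type) (V : Set ℝ) (φ : StateF AP) : Set ℝ :=
  {v | ∃ t : LTree D (AP → ℝ), ∃ u : List D,
    IsTree t ∧ Labelled t V ∧ u ∈ t.dom ∧ ssem φ t u = v}

def ValP (D : Type) (V : Set ℝ) (ψ : PathF AP) : Set ℝ :=
  {v | ∃ t : LTree D (AP → ℝ), ∃ u : List D, ∃ lam : ℕ → List D,
    IsTree t ∧ Labelled t V ∧ u ∈ t.dom ∧ IsBranch t u lam ∧ psem ψ t lam = v}

theorem sSup_mem_insert_zero {S s : Set ℝ} (hS : S.Finite) (hs : s ⊆ S) :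
    sSup s ∈ insert 0 S := by
  rcases s.eq_empty_or_nonempty with rfl | hne
  · simp
  · exact Or.inr (hs (hne.csSup_mem (hS.subset hs)))

theorem Labelled.of_propEquiv {V : Set ℝ} (h0 : (0 : ℝ) ∈ V) (h1 : (1 : ℝ) ∈ V) {p : AP}
    {t t' : LTree D (AP → ℝ)} (ht : Labelled t V) (h : PropEquiv p t t') : Labelled t' V := by
  intro u hu q
  rw [h.1] at hu
  obtain ⟨hne, hp⟩ := h.2 u hu
  by_cases hq : q = p
  · subst hq
    rcases hp with hp | hp <;> rwa [hp]
  · rw [hne q hq]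
    exact ht u hu q

mutual
/-- On trees with labels in a finite set, a state formula takes finitely many values. -/
theorem exists_finite_ssem {V : Set ℝ} (hV : V.Finite) (h0 : (0 : ℝ) ∈ V) (h1 : (1 : ℝ) ∈ V) :
    ∀ φ : StateF AP, ∃ S : Set ℝ, S.Finite ∧ ∀ t : LTree D (AP → ℝ), Labelled t V →
      ∀ u ∈ t.dom, ssem φ t u ∈ S
  | .atom p => ⟨V, hV, fun t ht u hu => by simpa only [ssem] using ht u hu p⟩
  | .app n f args => by
    have ih := fun i => exists_finite_ssem hV h0 h1 (args i)
    choose S hS hmem using ih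
    refine ⟨f '' Set.univ.pi S, (Set.Finite.pi' hS).image f |>.subset ?_, fun t ht u hu => ?_⟩
    · exact Set.image_mono fun x hx i => hx i trivial
    · rw [ssem]
      exact ⟨_, fun i _ => hmem i t ht u hu, rfl⟩
  | .ex p φ => by
    obtain ⟨S, hS, hmem⟩ := exists_finite_ssem hV h0 h1 φ
    refine ⟨insert 0 S, hS.insert 0, fun t ht u hu => ?_⟩
    rw [ssem]
    refine sSup_mem_insert_zero hS ?_
    rintro _ ⟨t', h, rfl⟩
    exact hmem t' (ht.of_propEquiv h0 h1 h) u (h.1 ▸ hu)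
  | .E ψ => by
    obtain ⟨S, hS, hmem⟩ := exists_finite_psem hV h0 h1 ψ
    refine ⟨insert 0 S, hS.insert 0, fun t ht u hu => ?_⟩
    rw [ssem]
    refine sSup_mem_insert_zero hS ?_
    rintro _ ⟨lam, h, rfl⟩
    exact hmem t ht lam fun i => (h.2 i).1

/-- On trees with labels in a finite set, a path formula takes finitely many values. -/
theorem exists_finite_psem {V : Set ℝ} (hV : V.Finite) (h0 : (0 : ℝ) ∈ V) (h1 : (1 : ℝ) ∈ V) :
    ∀ ψ : PathF AP, ∃ S : Set ℝ, S.Finite ∧ ∀ t : LTree D (AP → ℝ), Labelled t V →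
      ∀ lam : ℕ → List D, (∀ i, lam i ∈ t.dom) → psem ψ t lam ∈ S
  | .state φ => by
    obtain ⟨S, hS, hmem⟩ := exists_finite_ssem hV h0 h1 φ
    refine ⟨S, hS, fun t ht lam h => ?_⟩
    rw [psem]
    exact hmem t ht _ (h 0)
  | .next ψ => by
    obtain ⟨S, hS, hmem⟩ := exists_finite_psem hV h0 h1 ψ
    refine ⟨S, hS, fun t ht lam h => ?_⟩
    rw [psem]
    exact hmem t ht _ fun i => h (1 + i)
  | .until_ ψ₁ ψ₂ => by
    obtain ⟨S₁, hS₁, hmem₁⟩ := exists_finite_psem hV h0 h1 ψ₁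
    obtain ⟨S₂, hS₂, hmem₂⟩ := exists_finite_psem hV h0 h1 ψ₂
    have hfin : (S₂ ∪ (S₁ ∪ {1})).Finite := hS₂.union (hS₁.union (Set.finite_singleton 1))
    refine ⟨insert 0 (S₂ ∪ (S₁ ∪ {1})), hfin.insert 0, fun t ht lam h => ?_⟩
    rw [psem]
    refine sSup_mem_insert_zero hfin ?_
    rintro _ ⟨i, rfl⟩
    rcases min_choice (psem ψ₂ t fun k => lam (i + k))
      (sInf ({w | ∃ j < i, psem ψ₁ t (fun k => lam (j + k)) = w} ∪ {1})) with hm | hm <;> rw [hm]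
    · exact Or.inl (hmem₂ t ht _ fun k => h (i + k))
    · have hsub : {w | ∃ j < i, psem ψ₁ t (fun k => lam (j + k)) = w} ∪ {1} ⊆ S₁ ∪ {1} := by
        refine Set.union_subset_union_left _ ?_
        rintro _ ⟨j, -, rfl⟩
        exact hmem₁ t ht _ fun k => h (j + k)
      exact Or.inr (hsub (Set.Nonempty.csInf_mem ⟨1, Or.inr rfl⟩
        ((hS₁.union (Set.finite_singleton 1)).subset hsub)))
  | .app n f args => by
    have ih := fun i => exists_finite_psem hV h0 h1 (args i)
    choose S hS hmem using ih
    refine ⟨f '' Set.univ.pi S, (Set.Finite.pi' hS).image f |>.subset ?_, fun t ht lam h => ?_⟩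
    · exact Set.image_mono fun x hx i => hx i trivial
    · rw [psem]
      exact ⟨_, fun i _ => hmem i t ht lam h, rfl⟩
end

theorem IsTree.exists_isBranch {L : Type} {t : LTree D L} (ht : IsTree t) {u : List D}
    (hu : u ∈ t.dom) : ∃ lam, IsBranch t u lam := by
  choose d hd using ht.2.2
  let next : t.dom → t.dom := fun v => ⟨v.1 ++ [d v.1 v.2], hd v.1 v.2⟩
  refine ⟨fun i => (next^[i] ⟨u, hu⟩).1, rfl, fun i => ⟨(next^[i] ⟨u, hu⟩).2, ?_⟩⟩
  refine ⟨d _ (next^[i] ⟨u, hu⟩).2, ?_⟩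
  simp only [Function.iterate_succ_apply', next]

/-- The supremum defining `⟦Eψ⟧_t(u)` is attained: there is a branch
`λ ∈ Br_t(u)` realizing it; consequently the value belongs to `V(ψ)`. -/
theorem stmt4 {AP D : Type} [Fintype AP] [Fintype D] [Nonempty D]
    (V : Set ℝ) (hVfin : V.Finite) (hVsub : V ⊆ Set.Icc (0 : ℝ) 1)
    (h0 : (0 : ℝ) ∈ V) (h1 : (1 : ℝ) ∈ V)
    (ψ : PathF AP)
    (t : LTree D (AP → ℝ)) (ht : IsTree t) (hlab : Labelled t V)
    (u : List D) (hu : u ∈ t.dom) :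
    (∃ lam : ℕ → List D, IsBranch t u lam ∧
        psem ψ t lam = ssem (StateF.E ψ) t u) ∧
      ssem (StateF.E ψ) t u ∈ ValP D V ψ := by
  obtain ⟨S, hS, hmem⟩ := exists_finite_psem (D := D) hVfin h0 h1 ψ
  obtain ⟨lam₀, hlam₀⟩ := ht.exists_isBranch hu
  have hfin : {v | ∃ lam, IsBranch t u lam ∧ psem ψ t lam = v}.Finite := by
    refine hS.subset ?_
    rintro _ ⟨lam, h, rfl⟩
    exact hmem t hlab lam fun i => (h.2 i).1
  have hne : {v | ∃ lam, IsBranch t u lam ∧ psem ψ t lam = v}.Nonempty := ⟨_, lam₀, hlam₀, rfl⟩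
  obtain ⟨lam, hlam, heq⟩ := hne.csSup_mem hfin
  have hval : psem ψ t lam = ssem (StateF.E ψ) t u := by rw [heq, ssem]
  exact ⟨⟨lam, hlam, hval⟩, t, u, lam, ht, hlab, hu, hlam, hval⟩
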